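/- Quartic reciprocity: if α and β are primary, non-unit, relatively prime Gaussian integers, then (α/β)₄ · (β/α)₄⁻¹ = (−1)^(((Nα−1)/4)·((Nβ−1)/4)). -/

import Mathlib

open Zsqrtd

local notation "ℤ[i]" => GaussianInt

/-- The imaginary unit `i` in `ℤ[i]`. -/
def gi : ℤ[i] := Zsqrtd.sqrtd

/-- `α` is primary if `α ≡ 1 (mod 2(1+i))`. -/
def IsPrimary (α : ℤ[i]) : Prop := 2 * (1 + gi) ∣ α - 1
open scoped Classical in
/-- The quartic residue symbol `(α/π)₄`: the unique power of `i` congruent to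
`α ^ ((Nπ - 1)/4)` modulo `π`, where `Nπ` is the cardinality of `ℤ[i]/(π)`. -/
noncomputable def quartic (α π : ℤ[i]) : ℤ[i] :=
  if h : ∃ k : Fin 4,
      π ∣ α ^ ((Nat.card (ℤ[i] ⧸ Ideal.span {π}) - 1) / 4) - gi ^ (k : ℕ)
  then gi ^ ((h.choose : Fin 4) : ℕ) else 0

/-- The quartic residue symbol with composite denominator, extended
multiplicatively over the prime factors of the denominator. -/
noncomputable def quarticGen (α β : ℤ[i]) : ℤ[i] :=
  ((UniqueFactorizationMonoid.factors β).map fun π => quartic α π).prod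


lemma gi_re : gi.re = 0 := rfl
lemma gi_im : gi.im = 1 := rfl
lemma gi_sq : gi ^ 2 = -1 := by
  rw [pow_two]; ext <;> simp [gi]
lemma gi_mul : gi * gi = -1 := by rw [← pow_two, gi_sq]
lemma gi_four : gi ^ 4 = 1 := by
  rw [show 4 = 2 * 2 by rfl, pow_mul, gi_sq]; norm_num
lemma star_gi : star gi = -gi := by ext <;> simp [gi]

lemma fourth_cases (u : ℤ[i]) (h : u ^ 4 = 1) : u = 1 ∨ u = -1 ∨ u = gi ∨ u = -gi := by
  have : (u - 1) * ((u + 1) * ((u - gi) * (u + gi))) = 0 := by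
    linear_combination h + (1 - u ^ 2) * gi_mul
  rcases mul_eq_zero.1 this with h | h
  · left; exact sub_eq_zero.1 h
  rcases mul_eq_zero.1 h with h | h
  · right; left; exact eq_neg_of_add_eq_zero_left h
  rcases mul_eq_zero.1 h with h | h
  · right; right; left; exact sub_eq_zero.1 h
  · right; right; right; exact eq_neg_of_add_eq_zero_left h

lemma fourth_mul_star (u : ℤ[i]) (h : u ^ 4 = 1) : u * star u = 1 := by
  rcases fourth_cases u h with rfl | rfl | rfl | rfl <;> simp [star_gi, gi_mul]

lemma fourth_eq_pow (u : ℤ[i]) (h : u ^ 4 = 1) : ∃ k : Fin 4, u = gi ^ (k : ℕ) := by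
  rcases fourth_cases u h with rfl | rfl | rfl | rfl
  · exact ⟨0, by simp⟩
  · exact ⟨2, by simp [gi_sq]⟩
  · exact ⟨1, by simp⟩
  · exact ⟨3, by
      show -gi = gi ^ 3
      linear_combination (-gi) * gi_mul⟩

lemma fourth_sub_dvd_two (u v : ℤ[i]) (hu : u ^ 4 = 1) (hv : v ^ 4 = 1) (h : u ≠ v) :
    u - v ∣ 2 := by
  have key : ∀ w : ℤ[i], w ^ 4 = 1 → w ≠ 1 → w - 1 ∣ 2 := by
    intro w hw hne
    rcases fourth_cases w hw with rfl | rfl | rfl | rfl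
    · exact absurd rfl hne
    · exact ⟨-1, by norm_num⟩
    · exact ⟨-1 - gi, by linear_combination gi_mul⟩
    · exact ⟨-1 + gi, by linear_combination gi_mul⟩
  have hvs := fourth_mul_star v hv
  have h1 : (u * star v) ^ 4 = 1 := by rw [mul_pow, hu, ← star_pow, hv]; simp
  have h2 : u * star v ≠ 1 := by
    intro h'
    apply h
    linear_combination v * h' - u * hvs
  have := key _ h1 h2
  have e : u - v = v * (u * star v - 1) := by linear_combination (-u) * hvs
  rw [e]
  obtain ⟨c, hc⟩ := this
  exact ⟨c * star v, by linear_combination hc - (u * star v - 1) * c * hvs⟩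

lemma fourth_unique {π u v : ℤ[i]} (h2 : ¬ π ∣ 2) (hu : u ^ 4 = 1) (hv : v ^ 4 = 1)
    (h : π ∣ u - v) : u = v := by
  by_contra hne
  exact h2 (h.trans (fourth_sub_dvd_two u v hu hv hne))

/-- additive equivalence with pairs -/
def pairEquiv : ℤ[i] ≃ₗ[ℤ] (Fin 2 → ℤ) where
  toFun z := ![z.re, z.im]
  invFun v := ⟨v 0, v 1⟩
  left_inv z := by ext <;> simp
  right_inv v := by ext j; fin_cases j <;> simp
  map_add' x y := by ext j; fin_cases j <;> simp
  map_smul' c x := by ext j; fin_cases j <;> simp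

noncomputable def giBasis : Module.Basis (Fin 2) ℤ ℤ[i] := Module.Basis.ofEquivFun pairEquiv

lemma giBasis_zero : giBasis 0 = 1 := by
  simp [giBasis, Module.Basis.coe_ofEquivFun]
  ext <;> simp [pairEquiv]
lemma giBasis_one : giBasis 1 = gi := by
  simp [giBasis, Module.Basis.coe_ofEquivFun]
  ext <;> simp [pairEquiv, gi]
lemma giBasis_repr (z : ℤ[i]) (j : Fin 2) : giBasis.repr z j = ![z.re, z.im] j := by
  simp [giBasis, Module.Basis.ofEquivFun, pairEquiv]

instance : Module.Free ℤ ℤ[i] := Module.Free.of_basis giBasis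
instance : Module.Finite ℤ ℤ[i] := Module.Finite.of_basis giBasis

lemma algebra_norm_eq (z : ℤ[i]) : Algebra.norm ℤ z = z.norm := by
  rw [Algebra.norm_eq_matrix_det giBasis, Matrix.det_fin_two]
  simp only [Algebra.leftMulMatrix_eq_repr_mul, giBasis_repr, giBasis_zero, giBasis_one]
  simp [gi, Zsqrtd.norm_def]

lemma card_quot (z : ℤ[i]) : Nat.card (ℤ[i] ⧸ Ideal.span {z}) = z.norm.natAbs := by
  have := Ideal.absNorm_span_singleton z
  rw [algebra_norm_eq] at this
  rw [← this, Ideal.absNorm_apply, Submodule.cardQuot_apply]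

/-- The norm as a natural number. -/
def nn (z : ℤ[i]) : ℕ := z.norm.natAbs

lemma nn_mul (x y : ℤ[i]) : nn (x * y) = nn x * nn y := by
  simp [nn, Zsqrtd.norm_mul, Int.natAbs_mul]
lemma nn_cast (x : ℤ[i]) : (nn x : ℤ) = x.re ^ 2 + x.im ^ 2 := by
  rw [nn, GaussianInt.abs_natCast_norm, Zsqrtd.norm_def]; ring
lemma nn_star (x : ℤ[i]) : nn (star x) = nn x := by
  zify; rw [nn_cast, nn_cast]; simp
lemma nn_cast' (x : ℤ[i]) : (nn x : ℤ[i]) = x * star x := by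
  have : ((nn x : ℤ) : ℤ[i]) = (x.norm : ℤ[i]) := by
    rw [nn, GaussianInt.abs_natCast_norm]
  rw [← Zsqrtd.norm_eq_mul_conj, ← this]; simp

/-- An odd Gaussian integer. -/
def IsOdd (z : ℤ[i]) : Prop := IsCoprime z 2

lemma IsOdd.of_dvd {x y : ℤ[i]} (h : IsOdd y) (hd : x ∣ y) : IsOdd x :=
  IsCoprime.of_isCoprime_of_dvd_left h hd
lemma IsOdd.mul {x y : ℤ[i]} (hx : IsOdd x) (hy : IsOdd y) : IsOdd (x * y) :=
  IsCoprime.mul_left hx hy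
lemma IsOdd.conj {x : ℤ[i]} (hx : IsOdd x) : IsOdd (star x) := by
  obtain ⟨a, b, h⟩ := hx
  refine ⟨star a, star b, ?_⟩
  have := congrArg star h
  simp only [star_add, star_mul', star_one] at this
  rw [← this]; simp
lemma IsOdd.ne_zero {x : ℤ[i]} (hx : IsOdd x) : x ≠ 0 := by
  rintro rfl
  obtain ⟨a, b, h⟩ := hx
  have := congrArg Zsqrtd.re h
  simp at this
  omega
lemma IsOdd.not_dvd {x : ℤ[i]} (hx : IsOdd x) (hp : Prime x) : ¬ x ∣ 2 := fun h =>
  hp.not_isUnit (IsCoprime.isUnit_of_dvd' hx dvd_rfl h)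
lemma IsOdd.nn_mod {x : ℤ[i]} (hx : IsOdd x) : nn x % 4 = 1 := by
  have h : nn x % 2 = 1 := by
    by_contra hne
    have : (2 : ℕ) ∣ nn x := by omega
    obtain ⟨c, hc⟩ := this
    have h2 : IsOdd (x * star x) := hx.mul hx.conj
    rw [← nn_cast', hc] at h2
    obtain ⟨a, b, h⟩ := h2
    have := congrArg Zsqrtd.re h
    simp at this
    have : (2 : ℤ) ∣ 1 := ⟨a.re * c + b.re, by linear_combination -this⟩
    omega
  have e := nn_cast x
  have h' : (nn x : ℤ) % 2 = 1 := by omega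
  rcases Int.even_or_odd' x.re with ⟨a, ha | ha⟩ <;> rcases Int.even_or_odd' x.im with ⟨b, hb | hb⟩ <;>
    rw [ha, hb] at e <;> ring_nf at e <;> omega

lemma isPrimary_iff (z : ℤ[i]) : IsPrimary z ↔ z.im % 2 = 0 ∧ (z.re + z.im) % 4 = 1 := by
  constructor
  · rintro ⟨c, hc⟩
    have h1 := congrArg Zsqrtd.re hc
    have h2 := congrArg Zsqrtd.im hc
    simp [gi] at h1 h2
    omega
  · rintro ⟨h1, h2⟩
    refine ⟨⟨(z.re + z.im - 1) / 4, (z.im - z.re + 1) / 4⟩, ?_⟩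
    ext <;> simp [gi] <;> omega

lemma IsPrimary.isOdd {z : ℤ[i]} (h : IsPrimary z) : IsOdd z := by
  obtain ⟨c, hc⟩ := h
  exact ⟨1, - (1 + gi) * c, by linear_combination hc⟩
lemma IsPrimary.conj {z : ℤ[i]} (h : IsPrimary z) : IsPrimary (star z) := by
  rw [isPrimary_iff] at *
  simp; omega
lemma IsPrimary.mul {x y : ℤ[i]} (hx : IsPrimary x) (hy : IsPrimary y) : IsPrimary (x * y) := by
  obtain ⟨a, ha⟩ := hx
  obtain ⟨b, hb⟩ := hy
  exact ⟨a * y + b, by linear_combination y * ha + hb⟩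
lemma isPrimary_one : IsPrimary 1 := ⟨0, by simp⟩

lemma isUnit_fourth {u : ℤ[i]} (h : IsUnit u) : u ^ 4 = 1 := by
  have h1 : (nn u : ℤ) = 1 := by
    have := Zsqrtd.norm_eq_one_iff.2 h
    simp [nn, this]
  rw [nn_cast] at h1
  have hr : u.re ^ 2 ≤ 1 := by nlinarith [sq_nonneg u.im]
  have hi : u.im ^ 2 ≤ 1 := by nlinarith [sq_nonneg u.re]
  have a1 : u.re ≤ 1 := by nlinarith
  have a2 : -1 ≤ u.re := by nlinarith
  have b1 : u.im ≤ 1 := by nlinarith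
  have b2 : -1 ≤ u.im := by nlinarith
  obtain ⟨a, b⟩ := u
  simp only at *
  interval_cases a <;> interval_cases b <;> simp at h1 <;> decide

lemma fourth_isUnit {u : ℤ[i]} (h : u ^ 4 = 1) : IsUnit u :=
  IsUnit.of_pow_eq_one h (by norm_num)

/-- Associated primary elements are equal. -/
lemma primary_assoc {x y : ℤ[i]} (hx : IsPrimary x) (hy : IsPrimary y) (h : Associated x y) :
    x = y := by
  obtain ⟨u, hu⟩ := h
  rw [isPrimary_iff] at hx hy
  rw [← hu] at hy
  rcases fourth_cases _ (isUnit_fourth u.isUnit) with h | h | h | h <;> rw [h] at hu hy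
  · simpa using hu
  all_goals
    exfalso
    simp [gi] at hy
    omega

lemma exists_primary {x : ℤ[i]} (h : IsOdd x) : ∃ y, IsPrimary y ∧ Associated x y := by
  have hn := h.nn_mod
  have key : (x.re + x.im) % 2 = 1 := by
    have e := nn_cast x
    have h' : (nn x : ℤ) % 2 = 1 := by omega
    have : (x.re + x.im) % 2 = (x.re ^ 2 + x.im ^ 2) % 2 := by
      rcases Int.even_or_odd' x.re with ⟨a, ha | ha⟩ <;>
        rcases Int.even_or_odd' x.im with ⟨b, hb | hb⟩ <;> rw [ha, hb] <;> ring_nf <;> omega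
    omega
  have hgu : IsUnit gi := fourth_isUnit gi_four
  by_cases h0 : x.im % 2 = 0
  · by_cases h1 : (x.re + x.im) % 4 = 1
    · exact ⟨x, (isPrimary_iff x).2 ⟨h0, h1⟩, Associated.refl _⟩
    · exact ⟨-x, (isPrimary_iff _).2 ⟨by simp; omega, by simp; omega⟩, (Associated.neg_right (Associated.refl _))⟩
  · have hg : Associated x (x * gi) := ⟨hgu.unit, rfl⟩
    by_cases h1 : (x.re - x.im) % 4 = 1
    · exact ⟨x * gi, (isPrimary_iff _).2 ⟨by simp [gi]; omega, by simp [gi]; omega⟩, hg⟩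
    · exact ⟨-(x * gi), (isPrimary_iff _).2 ⟨by simp [gi]; omega, by simp [gi]; omega⟩, (Associated.neg_right hg)⟩


lemma odd_pow_card {π α : ℤ[i]} (hπ : Prime π) (h : ¬ π ∣ α) : π ∣ α ^ (nn π - 1) - 1 := by
  have hmax : (Ideal.span {π}).IsMaximal :=
    PrincipalIdealRing.isMaximal_of_irreducible hπ.irreducible
  let : Field (ℤ[i] ⧸ Ideal.span {π}) := Ideal.Quotient.field _
  have hc : Nat.card (ℤ[i] ⧸ Ideal.span {π}) = nn π := card_quot π
  have hne : nn π ≠ 0 := by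
    intro h0
    have := nn_cast' π
    rw [h0] at this
    simp at this
    exact hπ.ne_zero this
  have : Finite (ℤ[i] ⧸ Ideal.span {π}) := Nat.finite_of_card_ne_zero (by rw [hc]; exact hne)
  let := Fintype.ofFinite (ℤ[i] ⧸ Ideal.span {π})
  have hx : (Ideal.Quotient.mk (Ideal.span {π}) α) ≠ 0 := by
    rw [Ne, Ideal.Quotient.eq_zero_iff_dvd]; exact h
  have := FiniteField.pow_card_sub_one_eq_one _ hx
  rw [← Nat.card_eq_fintype_card, hc] at this
  rw [← Ideal.Quotient.eq_zero_iff_dvd, map_sub, map_pow, this]; simp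

lemma quartic_exists {π α : ℤ[i]} (hπ : Prime π) (ho : IsOdd π) (h : ¬ π ∣ α) :
    ∃ u, u ^ 4 = 1 ∧ π ∣ α ^ ((nn π - 1) / 4) - u := by
  have h1 := odd_pow_card hπ h
  have h4 : nn π - 1 = (nn π - 1) / 4 * 4 := by have := ho.nn_mod; omega
  rw [h4, pow_mul] at h1
  set y := α ^ ((nn π - 1) / 4)
  have e : y ^ 4 - 1 = (y - 1) * ((y - -1) * ((y - gi) * (y - -gi))) := by
    linear_combination (y ^ 2 - 1) * gi_mul
  rw [e] at h1
  rcases hπ.dvd_or_dvd h1 with h | h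
  · exact ⟨1, by simp, h⟩
  rcases hπ.dvd_or_dvd h with h | h
  · exact ⟨-1, by norm_num, h⟩
  rcases hπ.dvd_or_dvd h with h | h
  · exact ⟨gi, gi_four, h⟩
  · exact ⟨-gi, by rw [Even.neg_pow (by decide), gi_four], h⟩

lemma gi_pow_fourth (k : ℕ) : (gi ^ k) ^ 4 = 1 := by
  rw [← pow_mul, mul_comm, pow_mul, gi_four, one_pow]

lemma quartic_spec {π α : ℤ[i]} (hπ : Prime π) (ho : IsOdd π) (h : ¬ π ∣ α) :
    quartic α π ^ 4 = 1 ∧ π ∣ α ^ ((nn π - 1) / 4) - quartic α π := by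
  obtain ⟨u, hu, hd⟩ := quartic_exists hπ ho h
  obtain ⟨k, rfl⟩ := fourth_eq_pow u hu
  have hex : ∃ k : Fin 4,
      π ∣ α ^ ((Nat.card (ℤ[i] ⧸ Ideal.span {π}) - 1) / 4) - gi ^ (k : ℕ) := by
    rw [card_quot]; exact ⟨k, hd⟩
  rw [quartic, dif_pos hex]
  refine ⟨gi_pow_fourth _, ?_⟩
  have h3 : ∀ n, n = nn π → π ∣ α ^ ((n - 1) / 4) - gi ^ (hex.choose : ℕ) →
      π ∣ α ^ ((nn π - 1) / 4) - gi ^ (hex.choose : ℕ) := by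
    rintro n rfl h
    exact h
  exact h3 _ (card_quot π) hex.choose_spec

lemma quartic_unique {π α u : ℤ[i]} (hπ : Prime π) (ho : IsOdd π) (h : ¬ π ∣ α)
    (hu : u ^ 4 = 1) (hd : π ∣ α ^ ((nn π - 1) / 4) - u) : quartic α π = u := by
  obtain ⟨h1, h2⟩ := quartic_spec hπ ho h
  refine fourth_unique (ho.not_dvd hπ) h1 hu ?_
  have := dvd_sub hd h2
  rwa [sub_sub_sub_cancel_left] at this

lemma nn_ge {π : ℤ[i]} (hπ : Prime π) (ho : IsOdd π) : 5 ≤ nn π := by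
  have h1 := ho.nn_mod
  have h2 : nn π ≠ 1 := by
    intro h
    exact hπ.not_isUnit (Zsqrtd.norm_eq_one_iff.1 h)
  omega

lemma quartic_zero {π α : ℤ[i]} (hπ : Prime π) (ho : IsOdd π) (h : π ∣ α) : quartic α π = 0 := by
  rw [quartic, dif_neg]
  rintro ⟨k, hk⟩
  rw [card_quot] at hk
  have h5 := nn_ge hπ ho
  have hd : π ∣ α ^ ((nn π - 1) / 4) := dvd_pow h (by omega)
  have := (dvd_sub_right hd).1 hk
  exact hπ.not_isUnit (isUnit_of_dvd_unit this (fourth_isUnit (gi_pow_fourth _)))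

lemma quartic_mul {π : ℤ[i]} (hπ : Prime π) (ho : IsOdd π) (α β : ℤ[i]) :
    quartic (α * β) π = quartic α π * quartic β π := by
  by_cases ha : π ∣ α
  · rw [quartic_zero hπ ho ha, quartic_zero hπ ho (ha.mul_right β), zero_mul]
  by_cases hb : π ∣ β
  · rw [quartic_zero hπ ho hb, quartic_zero hπ ho (hb.mul_left α), mul_zero]
  obtain ⟨a1, a2⟩ := quartic_spec hπ ho ha
  obtain ⟨b1, b2⟩ := quartic_spec hπ ho hb
  refine quartic_unique hπ ho (fun h => (hπ.dvd_or_dvd h).elim ha hb) (by rw [mul_pow, a1, b1, one_mul]) ?_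
  obtain ⟨c, hc⟩ := a2
  obtain ⟨d, hd⟩ := b2
  exact ⟨c * β ^ ((nn π - 1) / 4) + quartic α π * d, by
    rw [mul_pow]; linear_combination β ^ ((nn π - 1) / 4) * hc + quartic α π * hd⟩

lemma quartic_congr {π : ℤ[i]} (hπ : Prime π) (ho : IsOdd π) {α β : ℤ[i]} (h : π ∣ α - β) :
    quartic α π = quartic β π := by
  by_cases ha : π ∣ α
  · rw [quartic_zero hπ ho ha, quartic_zero hπ ho ((dvd_sub_right ha).1 h)]
  have hb : ¬ π ∣ β := fun hb => ha ((dvd_sub_left hb).1 h)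
  obtain ⟨b1, b2⟩ := quartic_spec hπ ho hb
  refine quartic_unique hπ ho ha b1 ?_
  have := dvd_add (h.trans (sub_dvd_pow_sub_pow α β ((nn π - 1) / 4))) b2
  rwa [sub_add_sub_cancel] at this

open scoped Classical in
/-- The shape of the definition of `quartic`. -/
noncomputable def auxChoose (P : Fin 4 → Prop) : ℤ[i] :=
  if h : ∃ k : Fin 4, P k then gi ^ ((h.choose : Fin 4) : ℕ) else 0

lemma auxChoose_congr {P Q : Fin 4 → Prop} (h : P = Q) : auxChoose P = auxChoose Q := by rw [h]

lemma quartic_assoc {π π' : ℤ[i]} (h : Associated π π') (α : ℤ[i]) :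
    quartic α π = quartic α π' := by
  have hs : Ideal.span {π} = Ideal.span {π'} := Ideal.span_singleton_eq_span_singleton.2 h
  have : ∀ x, π ∣ x ↔ π' ∣ x := fun x => h.dvd_iff_dvd_left
  exact auxChoose_congr (funext fun k => propext (by rw [hs]; exact this _))

lemma star_dvd_star {x y : ℤ[i]} (h : x ∣ y) : star x ∣ star y := by
  obtain ⟨c, rfl⟩ := h
  exact ⟨star c, by simp [mul_comm]⟩

lemma prime_star {π : ℤ[i]} (h : Prime π) : Prime (star π) := by
  have := (MulEquiv.prime_iff (starRingAut (R := ℤ[i])).toMulEquiv (p := π)).2 h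
  simpa using this

lemma quartic_star {π : ℤ[i]} (hπ : Prime π) (ho : IsOdd π) (α : ℤ[i]) :
    quartic (star α) (star π) = star (quartic α π) := by
  by_cases ha : π ∣ α
  · rw [quartic_zero hπ ho ha, quartic_zero (prime_star hπ) ho.conj (star_dvd_star ha), star_zero]
  obtain ⟨b1, b2⟩ := quartic_spec hπ ho ha
  refine quartic_unique (prime_star hπ) ho.conj ?_ (by rw [← star_pow, b1, star_one]) ?_
  · intro h
    have := star_dvd_star h
    rw [star_star, star_star] at this
    exact ha this
  · have := star_dvd_star b2
    rw [star_sub, star_pow] at this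
    rwa [nn_star]

lemma quarticGen_eq_of_prod {s : Multiset ℤ[i]} (hs : ∀ x ∈ s, Prime x) {β : ℤ[i]} (h0 : β ≠ 0)
    (h : Associated s.prod β) (α : ℤ[i]) :
    quarticGen α β = (s.map (quartic α)).prod := by
  have hr : Multiset.Rel Associated s (UniqueFactorizationMonoid.factors β) :=
    prime_factors_unique hs (fun x hx => UniqueFactorizationMonoid.prime_of_factor x hx)
      (h.trans (UniqueFactorizationMonoid.factors_prod h0).symm)
  rw [quarticGen]
  have : (s.map (quartic α)) = (UniqueFactorizationMonoid.factors β).map (quartic α) := by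
    rw [← Multiset.rel_eq, Multiset.rel_map]
    exact hr.mono fun a _ b _ hab => quartic_assoc hab α
  rw [this]

lemma quarticGen_assoc {β γ : ℤ[i]} (h : Associated β γ) (h0 : β ≠ 0) (α : ℤ[i]) :
    quarticGen α β = quarticGen α γ := by
  symm
  refine quarticGen_eq_of_prod (fun x hx => UniqueFactorizationMonoid.prime_of_factor x hx)
    ?_ ((UniqueFactorizationMonoid.factors_prod h0).trans h) α
  rintro rfl
  exact h0 (associated_zero_iff_eq_zero _ |>.1 h)

lemma quarticGen_mul_right {β γ : ℤ[i]} (hb : β ≠ 0) (hc : γ ≠ 0) (α : ℤ[i]) :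
    quarticGen α (β * γ) = quarticGen α β * quarticGen α γ := by
  rw [quarticGen_eq_of_prod (s := UniqueFactorizationMonoid.factors β +
    UniqueFactorizationMonoid.factors γ) _ (mul_ne_zero hb hc)]
  · rw [Multiset.map_add, Multiset.prod_add]; rfl
  · rw [Multiset.prod_add]
    exact (UniqueFactorizationMonoid.factors_prod hb).mul_mul
      (UniqueFactorizationMonoid.factors_prod hc)
  · intro x hx
    rcases Multiset.mem_add.1 hx with h | h
    exacts [UniqueFactorizationMonoid.prime_of_factor x h, UniqueFactorizationMonoid.prime_of_factor x h]

lemma quarticGen_unit {β : ℤ[i]} (hb : IsUnit β) (α : ℤ[i]) : quarticGen α β = 1 := by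
  rw [quarticGen_eq_of_prod (s := 0) (by simp) hb.ne_zero]
  · simp
  · simpa using (associated_one_iff_isUnit.2 hb).symm

lemma quarticGen_prime {β : ℤ[i]} (hb : Prime β) (α : ℤ[i]) : quarticGen α β = quartic α β := by
  rw [quarticGen_eq_of_prod (s := {β}) (by simpa using hb) hb.ne_zero]
  · simp
  · simp

lemma odd_induction {P : ∀ β : ℤ[i], IsOdd β → Prop} (h1 : ∀ u (_ : IsUnit u) (ho : IsOdd u), P u ho)
    (h2 : ∀ π β (_ : Prime π) (ho : IsOdd π) (hb : IsOdd β), P β hb → P (π * β) (ho.mul hb))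
    (β : ℤ[i]) (hb : IsOdd β) : P β hb := by
  induction β using UniqueFactorizationMonoid.induction_on_prime with
  | h₁ => exact absurd rfl hb.ne_zero
  | h₂ x hx => exact h1 x hx hb
  | h₃ a p ha hp ih =>
    exact h2 p a hp (hb.of_dvd (dvd_mul_right _ _)) (hb.of_dvd (dvd_mul_left _ _))
      (ih (hb.of_dvd (dvd_mul_left _ _)))

lemma quarticGen_step {π β : ℤ[i]} (hπ : Prime π) (hb : IsOdd β) (α : ℤ[i]) :
    quarticGen α (π * β) = quartic α π * quarticGen α β := by
  rw [quarticGen_mul_right hπ.ne_zero hb.ne_zero, quarticGen_prime hπ]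

lemma quarticGen_mul_left {β : ℤ[i]} (hb : IsOdd β) (α α' : ℤ[i]) :
    quarticGen (α * α') β = quarticGen α β * quarticGen α' β := by
  induction β, hb using odd_induction with
  | h1 u hu _ => simp [quarticGen_unit hu]
  | h2 π β hπ ho hb ih =>
    rw [quarticGen_step hπ hb, quarticGen_step hπ hb, quarticGen_step hπ hb, ih, quartic_mul hπ ho]
    ring

lemma quarticGen_congr {β : ℤ[i]} (hb : IsOdd β) {α α' : ℤ[i]} (h : β ∣ α - α') :
    quarticGen α β = quarticGen α' β := by
  induction β, hb using odd_induction with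
  | h1 u hu _ => simp [quarticGen_unit hu]
  | h2 π β hπ ho hb ih =>
    rw [quarticGen_step hπ hb, quarticGen_step hπ hb, ih ((dvd_mul_left _ _).trans h),
      quartic_congr hπ ho ((dvd_mul_right _ _).trans h)]

lemma quarticGen_star {β : ℤ[i]} (hb : IsOdd β) (α : ℤ[i]) :
    quarticGen (star α) (star β) = star (quarticGen α β) := by
  induction β, hb using odd_induction with
  | h1 u hu _ => simp [quarticGen_unit hu, quarticGen_unit hu.star]
  | h2 π β hπ ho hb ih =>
    rw [star_mul', quarticGen_step hπ hb, quarticGen_step (prime_star hπ) hb.conj, ih,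
      quartic_star hπ ho, star_mul']

lemma quarticGen_fourth {β : ℤ[i]} (hb : IsOdd β) {α : ℤ[i]} (h : IsCoprime α β) :
    quarticGen α β ^ 4 = 1 := by
  induction β, hb using odd_induction with
  | h1 u hu _ => simp [quarticGen_unit hu]
  | h2 π β hπ ho hb ih =>
    rw [quarticGen_step hπ hb, mul_pow, ih (IsCoprime.of_mul_right_right h),
      (quartic_spec hπ ho _).1, one_mul]
    intro hd
    exact hπ.not_isUnit (IsCoprime.isUnit_of_dvd' (IsCoprime.of_mul_right_left h) hd dvd_rfl)

lemma gi_pow_mod (k : ℕ) : gi ^ k = gi ^ (k % 4) := by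
  conv_lhs => rw [← Nat.div_add_mod k 4, pow_add, pow_mul, gi_four, one_pow, one_mul]

lemma quarticGen_gi {β : ℤ[i]} (hb : IsOdd β) : quarticGen gi β = gi ^ ((nn β - 1) / 4) := by
  induction β, hb using odd_induction with
  | h1 u hu _ =>
    have : nn u = 1 := Zsqrtd.norm_eq_one_iff.2 hu
    simp [quarticGen_unit hu, this]
  | h2 π β hπ ho hb ih =>
    have hg : ¬ π ∣ gi := fun h =>
      hπ.not_isUnit (isUnit_of_dvd_unit h (fourth_isUnit gi_four))
    rw [quarticGen_step hπ hb, ih, quartic_unique hπ ho hg (gi_pow_fourth _) (by rw [sub_self]; exact dvd_zero _),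
      ← pow_add, gi_pow_mod, gi_pow_mod ((nn (π * β) - 1) / 4)]
    congr 1
    have a := ho.nn_mod
    have b := hb.nn_mod
    rw [nn_mul]
    obtain ⟨m, hm⟩ : ∃ m, nn π = 4 * m + 1 := ⟨nn π / 4, by omega⟩
    obtain ⟨n, hn⟩ : ∃ m, nn β = 4 * m + 1 := ⟨nn β / 4, by omega⟩
    rw [hm, hn]
    have : (4 * m + 1) * (4 * n + 1) = 4 * (4 * (m * n) + m + n) + 1 := by ring
    rw [this]
    omega

lemma quarticGen_neg_one {β : ℤ[i]} (hb : IsOdd β) :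
    quarticGen (-1) β = (-1) ^ ((nn β - 1) / 4) := by
  rw [← gi_sq, pow_two, quarticGen_mul_left hb, quarticGen_gi hb, ← mul_pow]


/-- A finite field presented as the residue field of `π`. -/
structure ResField (π : ℤ[i]) (F : Type) [Field F] [Fintype F] (f : ℤ[i] →+* F) : Prop where
  prime : Prime π
  odd : IsOdd π
  surj : Function.Surjective f
  ker : ∀ x, f x = 0 ↔ π ∣ x
  card : Fintype.card F = nn π

lemma exists_resField {π : ℤ[i]} (hπ : Prime π) (ho : IsOdd π) :
    ∃ (F : Type) (_ : Field F) (_ : Fintype F) (f : ℤ[i] →+* F), ResField π F f := by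
  have hmax : (Ideal.span {π}).IsMaximal :=
    PrincipalIdealRing.isMaximal_of_irreducible hπ.irreducible
  let _ : Field (ℤ[i] ⧸ Ideal.span {π}) := Ideal.Quotient.field _
  have hc : Nat.card (ℤ[i] ⧸ Ideal.span {π}) = nn π := card_quot π
  have hne : nn π ≠ 0 := by have := nn_ge hπ ho; omega
  have : Finite (ℤ[i] ⧸ Ideal.span {π}) := Nat.finite_of_card_ne_zero (by rw [hc]; exact hne)
  let _ := Fintype.ofFinite (ℤ[i] ⧸ Ideal.span {π})
  exact ⟨_, inferInstance, inferInstance, Ideal.Quotient.mk (Ideal.span {π}), hπ, ho,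
    Ideal.Quotient.mk_surjective, fun x => Ideal.Quotient.eq_zero_iff_dvd _ _, by
      rw [← Nat.card_eq_fintype_card, hc]⟩

section
variable {π : ℤ[i]} {F : Type} [Field F] [Fintype F] {f : ℤ[i] →+* F}

lemma ResField.exists_char (H : ResField π F f) :
    ∃ χ : MulChar F ℤ[i], ∀ a, χ (f a) = quartic a π := by
  have key : ∀ a b, f a = f b → quartic a π = quartic b π := fun a b hab =>
    quartic_congr H.prime H.odd ((H.ker _).1 (by rw [map_sub, hab, sub_self]))
  have hs : ∀ x, f (Function.surjInv H.surj x) = x := Function.surjInv_eq H.surj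
  refine ⟨{ toFun := fun x => quartic (Function.surjInv H.surj x) π
            map_one' := ?_
            map_mul' := ?_
            map_nonunit' := ?_ }, ?_⟩
  · rw [key _ 1 (by rw [hs, map_one])]
    refine quartic_unique H.prime H.odd (fun h => H.prime.not_isUnit (isUnit_of_dvd_one h)) (by simp) (by simp)
  · intro x y
    rw [← quartic_mul H.prime H.odd]
    exact key _ _ (by rw [map_mul, hs, hs, hs])
  · intro x hx
    rw [isUnit_iff_ne_zero, not_not] at hx
    exact quartic_zero H.prime H.odd ((H.ker _).1 (by rw [hs, hx]))
  · intro a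
    exact key _ _ (hs _)

variable {χ : MulChar F ℤ[i]}

lemma ResField.char_fourth (H : ResField π F f) (hχ : ∀ a, χ (f a) = quartic a π) {x : F}
    (hx : x ≠ 0) : χ x ^ 4 = 1 := by
  obtain ⟨a, rfl⟩ := H.surj x
  rw [hχ]
  exact (quartic_spec H.prime H.odd (fun h => hx ((H.ker _).2 h))).1

lemma ResField.f_char (H : ResField π F f) (hχ : ∀ a, χ (f a) = quartic a π) (x : F) :
    f (χ x) = x ^ ((Fintype.card F - 1) / 4) := by
  have h5 := nn_ge H.prime H.odd
  rw [H.card]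
  by_cases hx : x = 0
  · rw [hx, MulChar.map_zero, map_zero, zero_pow (by omega)]
  obtain ⟨a, rfl⟩ := H.surj x
  rw [hχ]
  have := (quartic_spec H.prime H.odd (fun h => hx ((H.ker a).2 h))).2
  rw [← H.ker, map_sub, map_pow, sub_eq_zero] at this
  exact this.symm

lemma ResField.two_ne (H : ResField π F f) : (2 : F) ≠ 0 := by
  intro h
  have : f 2 = 0 := by rw [← h]; exact map_ofNat f 2
  exact H.odd.not_dvd H.prime ((H.ker 2).1 this)

lemma ResField.ringChar_ne (H : ResField π F f) : ringChar F ≠ 2 := by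
  intro h
  apply H.two_ne
  have := ringChar.Nat.cast_ringChar (R := F)
  rw [h] at this
  simpa using this

lemma ResField.sq_ne_one (H : ResField π F f) (hχ : ∀ a, χ (f a) = quartic a π) : χ ^ 2 ≠ 1 := by
  intro h
  obtain ⟨a, ha⟩ := FiniteField.exists_nonsquare H.ringChar_ne
  have ha0 : a ≠ 0 := by rintro rfl; exact ha (IsSquare.zero)
  apply ha
  rw [FiniteField.isSquare_iff H.ringChar_ne ha0]
  have h1 : χ a ^ 2 = 1 := by
    rw [← MulChar.pow_apply' _ two_ne_zero, h, MulChar.one_apply (isUnit_iff_ne_zero.2 ha0)]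
  have h2 := congrArg f h1
  rw [map_pow, H.f_char hχ, ← pow_mul, map_one] at h2
  have : Fintype.card F / 2 = (Fintype.card F - 1) / 4 * 2 := by
    have := H.odd.nn_mod; rw [← H.card] at this; omega
  rw [this, h2]

lemma ResField.pow_four (H : ResField π F f) (hχ : ∀ a, χ (f a) = quartic a π) : χ ^ 4 = 1 := by
  apply MulChar.ext
  intro a
  rw [MulChar.pow_apply' _ (by norm_num), H.char_fourth hχ a.ne_zero, MulChar.one_apply_coe]

lemma ResField.inv_char (H : ResField π F f) (hχ : ∀ a, χ (f a) = quartic a π) (x : F) :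
    χ⁻¹ x = star (χ x) := by
  by_cases hx : x = 0
  · rw [hx, MulChar.map_zero, MulChar.map_zero, star_zero]
  have h1 := fourth_mul_star _ (H.char_fourth hχ hx)
  have h2 : χ x * χ⁻¹ x = 1 := by
    rw [← MulChar.mul_apply, mul_inv_cancel, MulChar.one_apply (isUnit_iff_ne_zero.2 hx)]
  linear_combination star (χ x) * h2 - χ⁻¹ x * h1

lemma ResField.nn_jacobi (H : ResField π F f) (hχ : ∀ a, χ (f a) = quartic a π) :
    nn (jacobiSum χ χ) = nn π := by
  have hinj : Function.Injective (GaussianInt.toComplex) := GaussianInt.toComplex_injective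
  have h2 := H.sq_ne_one hχ
  have h1 : χ ≠ 1 := by rintro rfl; simp at h2
  have hstar : jacobiSum χ⁻¹ χ⁻¹ = star (jacobiSum χ χ) := by
    simp only [jacobiSum, star_sum, star_mul', H.inv_char hχ]
  have hne : ∀ φ : MulChar F ℤ[i], φ ≠ 1 → φ.ringHomComp GaussianInt.toComplex ≠ 1 := by
    intro φ hφ h
    exact hφ ((MulChar.ringHomComp_eq_one_iff hinj).1 h)
  have hch : ringChar ℂ ≠ ringChar F := by
    rw [ringChar.eq_zero]
    exact (CharP.ringChar_ne_zero_of_finite F).symm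
  have := jacobiSum_mul_jacobiSum_inv hch (hne χ h1) (hne χ h1)
    (by rw [← MulChar.ringHomComp_mul, ← pow_two]; exact hne _ h2)
  rw [MulChar.ringHomComp_inv, jacobiSum_ringHomComp, jacobiSum_ringHomComp, ← map_mul, hstar,
    ← nn_cast', H.card] at this
  simpa using this

lemma ResField.f_jacobi (H : ResField π F f) (hχ : ∀ a, χ (f a) = quartic a π) :
    π ∣ jacobiSum χ χ := by
  rw [← H.ker, jacobiSum, map_sum]
  have h5 := nn_ge H.prime H.odd
  set k := (Fintype.card F - 1) / 4 with hk
  have hc := H.card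
  have e : ∀ x : F, f (χ x * χ (1 - x)) =
      ∑ m ∈ Finset.range (k + 1), (-1) ^ m * (k.choose m : F) * x ^ (k + m) := by
    intro x
    rw [map_mul, H.f_char hχ, H.f_char hχ, ← hk, show (1 - x : F) = -x + 1 by ring, add_pow,
      Finset.mul_sum]
    refine Finset.sum_congr rfl fun m _ => ?_
    rw [one_pow, neg_pow, pow_add]; ring
  simp_rw [e]
  rw [Finset.sum_comm]
  refine Finset.sum_eq_zero fun m hm => ?_
  rw [← Finset.mul_sum, FiniteField.sum_pow_lt_card_sub_one, mul_zero]
  rw [Finset.mem_range] at hm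
  omega

lemma fourth_two_mul {u : ℤ[i]} (hu : u ^ 4 = 1) : 2 * (1 + gi) ∣ 2 * (u - 1) := by
  apply mul_dvd_mul_left
  rcases fourth_cases u hu with rfl | rfl | rfl | rfl
  · simp
  · exact ⟨-1 + gi, by linear_combination -gi_mul⟩
  · exact ⟨gi, by linear_combination -gi_mul⟩
  · exact ⟨-1, by ring⟩

lemma ResField.neg_one_sq (χ : MulChar F ℤ[i]) : χ (-1) * χ (-1) = 1 := by
  rw [← map_mul]; simp

lemma ResField.char_half (H : ResField π F f) (hχ : ∀ a, χ (f a) = quartic a π) :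
    χ (2⁻¹) * χ (2⁻¹) = χ (-1) := by
  have h4 : (4 : F) = -1 * (f (1 + gi)) ^ 4 := by
    have : (4 : ℤ[i]) = -1 * (1 + gi) ^ 4 := by
      linear_combination (gi ^ 2 + 4 * gi + 5) * gi_mul
    have := congrArg f this
    rw [map_mul, map_pow, map_neg, map_one] at this
    rw [← this]; exact (map_ofNat f 4).symm
  have hne : f (1 + gi) ≠ 0 := by
    intro h
    rw [h] at h4
    apply H.two_ne
    have : (2 : F) * 2 = 0 := by rw [show (2 : F) * 2 = 4 by norm_num, h4]; simp
    exact mul_self_eq_zero.1 this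
  have h1 : χ 4 = χ (-1) := by
    rw [h4, map_mul, map_pow, H.char_fourth hχ hne, mul_one]
  have h2 : χ (2⁻¹) * χ (2⁻¹) * χ 4 = 1 := by
    rw [← map_mul, ← map_mul]
    have h22 : (2⁻¹ : F) * 2⁻¹ * 4 = 1 := by
      have := H.two_ne
      field_simp
      norm_num
    rw [h22, map_one]
  rw [h1] at h2
  linear_combination χ (-1) * h2 - χ (2⁻¹) * χ (2⁻¹) * (ResField.neg_one_sq χ)

lemma ResField.jacobi_congr (H : ResField π F f) (hχ : ∀ a, χ (f a) = quartic a π) :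
    2 * (1 + gi) ∣ jacobiSum χ χ - ((nn π : ℤ[i]) - 3 + χ (-1)) := by
  classical
  have h2 := H.two_ne
  have hh : (2⁻¹ : F) + 2⁻¹ = 1 := by field_simp; norm_num
  have hh0 : (2⁻¹ : F) ≠ 0 := inv_ne_zero h2
  have hh1 : (2⁻¹ : F) ≠ 1 := by
    intro h; rw [h] at hh
    exact one_ne_zero (by linear_combination hh : (1 : F) = 0)
  rw [← Ideal.Quotient.eq_zero_iff_dvd]
  set r := Ideal.Quotient.mk (Ideal.span {2 * (1 + gi)}) with hr
  let T : Finset F := {0, 1, 2⁻¹}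
  have hT : T.card = 3 := by
    rw [Finset.card_eq_three]
    exact ⟨0, 1, 2⁻¹, zero_ne_one, hh0.symm, hh1.symm, rfl⟩
  have hS : ∑ x ∈ Finset.univ \ T, (r (χ x * χ (1 - x)) - 1) = 0 := by
    refine Finset.sum_involution (fun x _ => 1 - x) ?_ ?_ ?_ ?_
    · intro x hx
      simp only [T, Finset.mem_sdiff, Finset.mem_univ, true_and, Finset.mem_insert,
        Finset.mem_singleton, not_or] at hx
      have hu : (χ x * χ (1 - x)) ^ 4 = 1 := by
        rw [mul_pow, H.char_fourth hχ hx.1, H.char_fourth hχ (sub_ne_zero.2 (Ne.symm hx.2.1)), one_mul]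
      have := fourth_two_mul hu
      rw [← Ideal.Quotient.eq_zero_iff_dvd] at this
      have e : (2 : ℤ[i]) * (χ x * χ (1 - x) - 1) =
          (χ x * χ (1 - x) - 1) + (χ x * χ (1 - x) - 1) := by ring
      rw [e, map_add, map_sub, map_one] at this
      rw [sub_sub_cancel, mul_comm (χ (1 - x))]
      exact this
    · intro x hx _ hxx
      simp only [T, Finset.mem_sdiff, Finset.mem_univ, true_and, Finset.mem_insert,
        Finset.mem_singleton, not_or] at hx
      apply hx.2.2
      apply mul_left_cancel₀ h2
      linear_combination -hxx - hh
    · intro x hx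
      simp only [T, Finset.mem_sdiff, Finset.mem_univ, true_and, Finset.mem_insert,
        Finset.mem_singleton, not_or] at hx ⊢
      refine ⟨sub_ne_zero.2 (Ne.symm hx.2.1), ?_, ?_⟩
      · intro h; apply hx.1; linear_combination -h
      · intro h; apply hx.2.2; linear_combination -hh - h
    · intro x hx; ring
  rw [Finset.sum_sub_distrib, Finset.sum_const, nsmul_one, sub_eq_zero, ← map_sum] at hS
  have hcard : ((Finset.univ \ T).card : ℤ[i]) = (nn π : ℤ[i]) - 3 := by
    rw [Finset.card_sdiff_of_subset (Finset.subset_univ _), hT, Finset.card_univ, H.card,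
      Nat.cast_sub (by have := nn_ge H.prime H.odd; omega)]
    rfl
  have hJ : jacobiSum χ χ = ∑ x ∈ Finset.univ \ T, (χ x * χ (1 - x)) + χ (-1) := by
    rw [jacobiSum, ← Finset.sum_sdiff (Finset.subset_univ T)]
    congr 1
    rw [Finset.sum_insert, Finset.sum_insert, Finset.sum_singleton]
    · rw [show (1 : F) - 2⁻¹ = 2⁻¹ by linear_combination -hh, H.char_half hχ, sub_self, MulChar.map_zero, zero_mul, mul_zero, zero_add, zero_add]
    · simpa using hh1.symm
    · simpa using hh0.symm
  rw [hJ, ← hcard, map_sub, map_add, hS, map_add, map_natCast]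
  ring

/-- The evaluation of the quartic Jacobi sum. -/
lemma ResField.jacobi_eq (H : ResField π F f) (hχ : ∀ a, χ (f a) = quartic a π)
    (hp : IsPrimary π) : jacobiSum χ χ = - χ (-1) * π := by
  have hsq := ResField.neg_one_sq χ
  have hprim : IsPrimary (- χ (-1) * jacobiSum χ χ) := by
    obtain ⟨c, hc⟩ := H.jacobi_congr hχ
    obtain ⟨m, hm⟩ : ∃ m, nn π = 4 * m + 1 := ⟨nn π / 4, by have := H.odd.nn_mod; omega⟩
    rw [hm] at hc
    push_cast at hc
    rcases mul_self_eq_one_iff.1 hsq with h | h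
    · rw [h] at hc ⊢
      exact ⟨-c - (1 - gi) * m, by linear_combination -hc - 2 * m * gi_mul⟩
    · rw [h] at hc ⊢
      exact ⟨c + (1 - gi) * (m - 1), by linear_combination hc + 2 * (m - 1) * gi_mul⟩
  obtain ⟨c, hc⟩ := H.f_jacobi hχ
  have hn := H.nn_jacobi hχ
  rw [hc, nn_mul] at hn
  have h5 := nn_ge H.prime H.odd
  have hc1 : nn c = 1 := Nat.eq_of_mul_eq_mul_left (by omega : 0 < nn π) (by rw [hn, mul_one])
  have hcu : IsUnit c := Zsqrtd.norm_eq_one_iff.1 hc1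
  have hass : Associated π (- χ (-1) * jacobiSum χ χ) := by
    have hu : IsUnit (- χ (-1) * c) := by
      refine IsUnit.mul ?_ hcu
      exact (IsUnit.of_mul_eq_one _ hsq).neg
    exact ⟨hu.unit, by rw [IsUnit.unit_spec, hc]; ring⟩
  have := primary_assoc hp hprim hass
  linear_combination (χ (-1)) * this - jacobiSum χ χ * hsq
end


section
variable {l : ℤ[i]} {F : Type} [Field F] [Fintype F] {f : ℤ[i] →+* F} {χ : MulChar F ℤ[i]}
  {L : Type*} [Field L] {φ : ℤ[i] →+* L} {ψ : AddChar F L}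

lemma ResField.comp_sq_ne_one (H : ResField l F f) (hχ : ∀ a, χ (f a) = quartic a l)
    (h2 : (2 : L) ≠ 0) : (χ.ringHomComp φ) ^ 2 ≠ 1 := by
  intro h
  apply H.sq_ne_one hχ
  apply MulChar.ext
  intro a
  rw [MulChar.pow_apply' _ two_ne_zero, MulChar.one_apply_coe]
  have h4 := H.char_fourth hχ a.ne_zero
  have : (χ a ^ 2) * (χ a ^ 2) = 1 := by rw [← pow_add, h4]
  rcases mul_self_eq_one_iff.1 this with h' | h'
  · exact h'
  exfalso
  have e : ((χ.ringHomComp φ) ^ 2) a = 1 := by rw [h, MulChar.one_apply_coe]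
  rw [MulChar.pow_apply' _ two_ne_zero, MulChar.ringHomComp_apply, ← map_pow, h', map_neg, map_one] at e
  apply h2
  linear_combination -e

lemma ResField.gauss_fourth (H : ResField l F f) (hχ : ∀ a, χ (f a) = quartic a l)
    (hp : IsPrimary l) (h2 : (2 : L) ≠ 0) (hψ : ψ.IsPrimitive) :
    gaussSum (χ.ringHomComp φ) ψ ^ 4 = φ (l ^ 3 * star l) := by
  set X := χ.ringHomComp φ with hX
  have hne : X ^ 2 ≠ 1 := H.comp_sq_ne_one hχ h2
  have hJ := jacobiSum_mul_nontrivial (χ := X) (φ := X) (by rwa [← pow_two]) ψ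
  have hquad : (X ^ 2).IsQuadratic := by
    intro a
    by_cases ha : a = 0
    · left; rw [ha, MulChar.map_zero]
    right
    rw [MulChar.pow_apply' _ two_ne_zero, hX, MulChar.ringHomComp_apply]
    have h4 := H.char_fourth hχ ha
    apply mul_self_eq_one_iff.1
    rw [← pow_add, ← map_pow, h4, map_one]
  have hg2 := gaussSum_sq hne hquad hψ
  rw [MulChar.pow_apply' _ two_ne_zero, pow_two (X (-1)), ← map_mul, neg_mul_neg, one_mul, map_one,
    one_mul, H.card] at hg2
  have hJ' : jacobiSum X X = φ (- χ (-1) * l) := by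
    rw [hX, jacobiSum_ringHomComp, H.jacobi_eq hχ hp]
  rw [hJ', ← pow_two X] at hJ
  have hq : ((nn l : ℕ) : L) = φ (l * star l) := by rw [← nn_cast', map_natCast]
  have hs := congrArg φ (ResField.neg_one_sq χ)
  rw [map_mul, map_one] at hs
  calc gaussSum X ψ ^ 4 = (gaussSum X ψ * gaussSum X ψ) ^ 2 := by ring
    _ = (gaussSum (X ^ 2) ψ) ^ 2 * φ (- χ (-1) * l) ^ 2 := by rw [← hJ, mul_pow]
    _ = φ (l * star l) * φ (- χ (-1) * l) ^ 2 := by rw [hg2, hq]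
    _ = φ (l ^ 3 * star l) := by
      rw [← map_pow, ← map_mul]
      congr 1
      linear_combination (l ^ 3 * star l) * (ResField.neg_one_sq χ)

lemma ResField.comp_pow_four (H : ResField l F f) (hχ : ∀ a, χ (f a) = quartic a l) :
    (χ.ringHomComp φ) ^ 4 = 1 := by
  rw [MulChar.ringHomComp_pow, H.pow_four hχ, MulChar.ringHomComp_one]

lemma ResField.gauss_one (H : ResField l F f) (hχ : ∀ a, χ (f a) = quartic a l)
    (hp : IsPrimary l) (h2 : (2 : L) ≠ 0) (hψ : ψ.IsPrimitive) (p : ℕ) [Fact p.Prime] [CharP L p]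
    (hpF : (p : F) ≠ 0) (hl : φ (l * star l) ≠ 0) (h1 : p % 4 = 1) :
    φ (quartic p l * (l ^ 3 * star l) ^ ((p - 1) / 4)) = 1 := by
  have hg4 := H.gauss_fourth (φ := φ) hχ hp h2 hψ
  set X := χ.ringHomComp φ with hX
  have hX4 : X ^ 4 = 1 := H.comp_pow_four hχ
  have hXp : X ^ p = X := by
    conv_lhs => rw [← Nat.div_add_mod p 4, h1, pow_add, pow_mul, hX4, one_pow, one_mul, pow_one]
  have hfrob := gaussSum_frob p X ψ
  rw [hXp, AddChar.pow_mulShift] at hfrob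
  have hsh := gaussSum_mulShift X ψ (Units.mk0 (p : F) hpF)
  rw [Units.val_mk0, ← hfrob] at hsh
  have hg0 : gaussSum X ψ ≠ 0 := by
    intro h0
    rw [h0, zero_pow (by norm_num)] at hg4
    rw [map_mul, map_pow] at hg4
    rw [map_mul] at hl
    rcases mul_ne_zero_iff.1 hl with ⟨ha, hb⟩
    exact (mul_ne_zero (pow_ne_zero 3 ha) hb) hg4.symm
  have hXpp : X (p : F) = φ (quartic p l) := by
    rw [hX, MulChar.ringHomComp_apply, ← hχ, map_natCast f]
  rw [map_mul, map_pow, ← hg4, ← pow_mul, ← hXpp]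
  apply mul_right_cancel₀ hg0
  rw [one_mul, mul_assoc, ← pow_succ]
  have : 4 * ((p - 1) / 4) + 1 = p := by omega
  rw [this, hsh]

lemma ResField.gauss_three (H : ResField l F f) (hχ : ∀ a, χ (f a) = quartic a l)
    (hp : IsPrimary l) (h2 : (2 : L) ≠ 0) (hψ : ψ.IsPrimitive) (p : ℕ) [Fact p.Prime] [CharP L p]
    (hpF : (p : F) ≠ 0) (h1 : p % 4 = 3) :
    φ ((l ^ 3 * star l) ^ ((p + 1) / 4)) = φ (quartic (-p) l * (l * star l)) := by
  have hg4 := H.gauss_fourth (φ := φ) hχ hp h2 hψ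
  have hne : (χ.ringHomComp φ) ^ 2 ≠ 1 := H.comp_sq_ne_one hχ h2
  set X := χ.ringHomComp φ with hX
  have hX1 : X ≠ 1 := by rintro h; rw [h] at hne; simp at hne
  have hX4 : X ^ 4 = 1 := H.comp_pow_four hχ
  have hXp : X ^ p = X⁻¹ := by
    conv_lhs => rw [← Nat.div_add_mod p 4, h1, pow_add, pow_mul, hX4, one_pow, one_mul]
    rw [eq_inv_iff_mul_eq_one, ← pow_succ, hX4]
  have hfrob := gaussSum_frob p X ψ
  rw [hXp, AddChar.pow_mulShift] at hfrob
  have hsh := gaussSum_mulShift X⁻¹ ψ (Units.mk0 (p : F) hpF)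
  rw [Units.val_mk0, ← hfrob] at hsh
  have hXpp : X (-(p : F)) = φ (quartic (-p) l) := by
    rw [hX, MulChar.ringHomComp_apply, ← hχ, map_neg f, map_natCast f]
  have hinv : X (p : F) * X⁻¹ (p : F) = 1 := by
    rw [← MulChar.mul_apply, mul_inv_cancel, MulChar.one_apply (isUnit_iff_ne_zero.2 hpF)]
  have hcard := gaussSum_mul_gaussSum_eq_card hX1 hψ
  have hm := mul_gaussSum_inv_eq_gaussSum X⁻¹ ψ
  have hinv1 : X⁻¹ (-1) = X (-1) := by rw [MulChar.inv_apply', inv_neg_one]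
  have hneg : X (-(p : F)) = X (-1) * X p := by rw [← map_mul]; simp
  have hq : ((nn l : ℕ) : L) = φ (l * star l) := by rw [← nn_cast', map_natCast]
  rw [hinv1] at hm
  rw [H.card, hq] at hcard
  rw [map_pow, ← hg4, ← pow_mul, map_mul, ← hXpp, hneg, ← hcard]
  have : 4 * ((p + 1) / 4) = p + 1 := by omega
  rw [this, pow_succ]
  linear_combination (-gaussSum X ψ ^ p * gaussSum X ψ) * hinv + X (p : F) * gaussSum X ψ * hsh - X (p : F) * gaussSum X ψ * hm
end

lemma rat_setup {l : ℤ[i]} (hl : Prime l) (hp : IsPrimary l) {p : ℕ} (hpp : p.Prime)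
    (hp2 : p ≠ 2) (hcop : IsCoprime (p : ℤ[i]) l) {m : ℤ[i]} (hm : Prime m) (hmp : m ∣ (p : ℤ[i])) :
    ((p % 4 = 1) → m ∣ quartic p l * (l ^ 3 * star l) ^ ((p - 1) / 4) - 1) ∧
    ((p % 4 = 3) → m ∣ (l ^ 3 * star l) ^ ((p + 1) / 4) - quartic (-p) l * (l * star l)) := by
  have : Fact p.Prime := ⟨hpp⟩
  have hpodd : IsOdd (p : ℤ[i]) := by
    have h : IsCoprime (p : ℤ) ((2 : ℕ) : ℤ) :=
      Nat.Coprime.isCoprime ((Nat.coprime_primes hpp Nat.prime_two).2 hp2)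
    have := h.map (Int.castRingHom ℤ[i])
    simpa [IsOdd] using this
  have hmo : IsOdd m := hpodd.of_dvd hmp
  obtain ⟨F, _, _, f, H⟩ := exists_resField hl hp.isOdd
  obtain ⟨K, _, _, k, HK⟩ := exists_resField hm hmo
  obtain ⟨χ, hχ⟩ := H.exists_char
  have hpF : (p : F) ≠ 0 := by
    intro h
    have : l ∣ (p : ℤ[i]) := by rw [← H.ker, map_natCast, h]
    exact hl.not_isUnit (IsCoprime.isUnit_of_dvd' hcop this dvd_rfl)
  have hpK : (p : K) = 0 := by
    rw [← map_natCast k, HK.ker]; exact hmp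
  have hchK : CharP K p := by
    have h1 : ringChar K = p :=
      ((Nat.dvd_prime hpp).1 (ringChar.dvd hpK)).resolve_left CharP.ringChar_ne_one
    exact ringChar.of_eq h1
  have hr : ringChar K ≠ ringChar F := by
    rw [ringChar.eq K p]
    intro h
    apply hpF
    rw [h]
    exact ringChar.Nat.cast_ringChar
  let ψ := AddChar.FiniteField.primitiveChar F K hr
  let L := CyclotomicField ψ.n K
  have hchL : CharP L p := charP_of_injective_algebraMap (algebraMap K L).injective p
  have h2 : (2 : L) ≠ 0 := by
    have := (algebraMap K L).injective.ne HK.two_ne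
    rwa [map_zero, map_ofNat] at this
  let φ : ℤ[i] →+* L := (algebraMap K L).comp k
  have hφ : ∀ x, φ x = 0 ↔ m ∣ x := by
    intro x
    rw [← HK.ker, RingHom.comp_apply, map_eq_zero_iff _ (algebraMap K L).injective]
  have hψ : ψ.char.IsPrimitive := ψ.prim
  constructor
  · intro h1
    rw [← hφ, map_sub, map_one, sub_eq_zero]
    refine H.gauss_one hχ hp h2 hψ p hpF ?_ h1
    rw [Ne, hφ]
    rw [← nn_cast', ← hφ, map_natCast, CharP.cast_eq_zero_iff L p]
    intro hd
    apply hpF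
    obtain ⟨c, hc⟩ := hd
    have e1 : ((nn l : ℕ) : F) = 0 := by rw [← H.card]; simp
    -- the characteristic of F divides a power only
    have e2 : ringChar F ∣ nn l := ringChar.dvd e1
    obtain ⟨n, hprime, hcard⟩ := FiniteField.card F (ringChar F)
    rw [H.card] at hcard
    have : p ∣ ringChar F ^ (n : ℕ) := by rw [← hcard, hc]; exact dvd_mul_right _ _
    have := (Nat.prime_dvd_prime_iff_eq hpp hprime).1 (hpp.dvd_of_dvd_pow this)
    rw [this]
    exact ringChar.Nat.cast_ringChar
  · intro h3
    rw [← hφ, map_sub, sub_eq_zero]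
    exact H.gauss_three hχ hp h2 hψ p hpF h3


lemma not_dvd_of_coprime {l a : ℤ[i]} (hl : Prime l) (h : IsCoprime a l) : ¬ l ∣ a := fun hd =>
  hl.not_isUnit (IsCoprime.isUnit_of_dvd' h hd dvd_rfl)

lemma prime_of_nn {m : ℤ[i]} (h : (nn m).Prime) : Prime m := by
  apply Irreducible.prime
  constructor
  · intro hu
    have : nn m = 1 := Zsqrtd.norm_eq_one_iff.2 hu
    rw [this] at h; exact Nat.not_prime_one h
  · intro x y hxy
    rw [hxy, nn_mul, Nat.prime_mul_iff] at h
    rcases h with ⟨_, h⟩ | ⟨_, h⟩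
    · right; exact Zsqrtd.norm_eq_one_iff.1 h
    · left; exact Zsqrtd.norm_eq_one_iff.1 h

lemma isOdd_intCast {a : ℤ} (h : a % 2 = 1) : IsOdd (a : ℤ[i]) := by
  refine ⟨1, ((-(a / 2) : ℤ) : ℤ[i]), ?_⟩
  have : a = 2 * (a / 2) + 1 := by omega
  have h2 : (a : ℤ[i]) = 2 * ((a / 2 : ℤ) : ℤ[i]) + 1 := by
    conv_lhs => rw [this]
    push_cast; ring
  rw [Int.cast_neg]
  linear_combination h2

lemma isOdd_natCast {a : ℕ} (h : a % 2 = 1) : IsOdd (a : ℤ[i]) := by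
  have := isOdd_intCast (a := (a : ℤ)) (by omega)
  simpa using this

lemma quarticGen_one_left {β : ℤ[i]} (hb : IsOdd β) : quarticGen 1 β = 1 := by
  have h1 := quarticGen_mul_left hb 1 1
  have h4 := quarticGen_fourth hb (isCoprime_one_left (x := β))
  rw [one_mul] at h1
  have h0 : quarticGen 1 β ≠ 0 := by
    intro h; rw [h] at h4; norm_num at h4
  exact (mul_left_cancel₀ h0 (by rw [mul_one]; exact h1)).symm

lemma split_prime {p : ℕ} (hpp : p.Prime) (h1 : p % 4 = 1) :
    ∃ m : ℤ[i], Prime m ∧ nn m = p ∧ (p : ℤ[i]) = m * star m := by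
  have : Fact p.Prime := ⟨hpp⟩
  obtain ⟨a, b, hab⟩ := Nat.Prime.sq_add_sq (p := p) (by omega)
  have hn : nn (⟨a, b⟩ : ℤ[i]) = p := by
    zify; rw [nn_cast]; push_cast [← hab]; ring
  refine ⟨⟨a, b⟩, prime_of_nn (by rwa [hn]), hn, ?_⟩
  rw [← nn_cast', hn]

lemma rat_one {l : ℤ[i]} (hl : Prime l) (hp : IsPrimary l) {p : ℕ} (hpp : p.Prime)
    (h1 : p % 4 = 1) (hcop : IsCoprime (p : ℤ[i]) l) : quartic p l = quarticGen l p := by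
  obtain ⟨m, hm, hn, hpm⟩ := split_prime hpp h1
  have hpo : IsOdd (p : ℤ[i]) := isOdd_natCast (by omega)
  have hmp : m ∣ (p : ℤ[i]) := hpm ▸ dvd_mul_right _ _
  have hsp : star m ∣ (p : ℤ[i]) := hpm ▸ dvd_mul_left _ _
  have hmo := hpo.of_dvd hmp
  have hso := hpo.of_dvd hsp
  have hs := prime_star hm
  have n1 : ¬ m ∣ l := not_dvd_of_coprime hm (hcop.of_isCoprime_of_dvd_left hmp).symm
  have n2 : ¬ star m ∣ l := not_dvd_of_coprime hs (hcop.of_isCoprime_of_dvd_left hsp).symm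
  have n3 : ¬ m ∣ star l := fun h => n2 (by simpa using star_dvd_star h)
  have n4 : ¬ l ∣ (p : ℤ[i]) := not_dvd_of_coprime hl hcop
  have key := (rat_setup hl hp hpp (by omega) hcop hm hmp).1 h1
  have e : quartic (star l) m = star (quartic l (star m)) := by
    have := quartic_star hs hso l
    rwa [star_star] at this
  have hQ := (quartic_spec hl hp.isOdd n4).1
  have hu := (quartic_spec hm hmo n1).1
  have hv := (quartic_spec hs hso n2).1
  have hv' := (quartic_spec hm hmo n3).1
  have hW : ¬ m ∣ l ^ 3 * star l := by
    intro h
    rcases hm.dvd_or_dvd h with h | h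
    · exact n1 (hm.dvd_of_dvd_pow h)
    · exact n3 h
  obtain ⟨w1, w2⟩ := quartic_spec hm hmo hW
  rw [hn] at w2
  have hWe : quartic (l ^ 3 * star l) m = quartic l m ^ 3 * quartic (star l) m := by
    rw [show l ^ 3 * star l = l * (l * (l * star l)) by ring]
    simp only [quartic_mul hm hmo]; ring
  have hfin : quartic p l * quartic (l ^ 3 * star l) m = 1 := by
    apply fourth_unique (hmo.not_dvd hm) (by rw [mul_pow, hQ, w1, one_mul]) (one_pow 4)
    have := dvd_sub key (w2.mul_left (quartic p l))
    convert this using 1; ring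
  rw [hWe, e] at hfin
  have hvs := fourth_mul_star _ hv
  rw [hpm, quarticGen_mul_right hm.ne_zero hs.ne_zero, quarticGen_prime hm, quarticGen_prime hs, ← hpm]
  linear_combination (-quartic (p : ℤ[i]) l) * hu
    + quartic l m * quartic l (star m) * hfin - quartic (p : ℤ[i]) l * quartic l m ^ 4 * hvs

lemma star_frob {p : ℕ} (hpp : p.Prime) (h3 : p % 4 = 3) (l : ℤ[i]) :
    (p : ℤ[i]) ∣ l ^ p - star l := by
  have : Fact p.Prime := ⟨hpp⟩
  have hf : ∀ a : ℤ, (p : ℤ[i]) ∣ (a : ℤ[i]) ^ p - a := by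
    intro a
    have : (p : ℤ) ∣ a ^ p - a := by
      rw [← ZMod.intCast_zmod_eq_zero_iff_dvd] <;> simp [ZMod.pow_card]
    have := map_dvd (Int.castRingHom ℤ[i]) this
    simpa using this
  have hl : l = (l.re : ℤ[i]) + (l.im : ℤ[i]) * gi := by
    ext <;> simp [gi]
  have hs : star l = (l.re : ℤ[i]) - (l.im : ℤ[i]) * gi := by
    ext <;> simp [gi]
  obtain ⟨r, hr⟩ := exists_add_pow_prime_eq hpp (l.re : ℤ[i]) ((l.im : ℤ[i]) * gi)
  rw [← hl, mul_pow, gi_pow_mod p, h3] at hr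
  obtain ⟨x, hx⟩ := hf l.re
  obtain ⟨y, hy⟩ := hf l.im
  have g3 : gi ^ 3 = - gi := by linear_combination gi * gi_sq
  rw [g3] at hr
  refine ⟨(l.re : ℤ[i]) * ((l.im : ℤ[i]) * gi) * r + x - y * gi, ?_⟩
  rw [hr, hs]
  linear_combination hx - gi * hy

lemma rat_three {l : ℤ[i]} (hl : Prime l) (hp : IsPrimary l) {p : ℕ} (hpp : p.Prime)
    (h3 : p % 4 = 3) (hcop : IsCoprime (p : ℤ[i]) l) : quartic (-p) l = quarticGen l p := by
  have : Fact p.Prime := ⟨hpp⟩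
  have hP : Prime (p : ℤ[i]) := GaussianInt.prime_of_nat_prime_of_mod_four_eq_three p h3
  have hpo : IsOdd (p : ℤ[i]) := isOdd_natCast (by omega)
  have key := (rat_setup hl hp hpp (by omega) hcop hP dvd_rfl).2 h3
  have n1 : ¬ (p : ℤ[i]) ∣ l := not_dvd_of_coprime hP hcop.symm
  have n4 : ¬ l ∣ -(p : ℤ[i]) := fun h => not_dvd_of_coprime hl hcop (by simpa using h)
  have hQ := (quartic_spec hl hp.isOdd n4).1
  have hn : nn (p : ℤ[i]) = p ^ 2 := by
    zify; rw [nn_cast]; simp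
  rw [quarticGen_prime hP]
  symm
  apply quartic_unique hP hpo n1 hQ
  obtain ⟨k, hk⟩ : ∃ k, p + 1 = 4 * k := ⟨(p + 1) / 4, by omega⟩
  have hexp : (p + 3) * k = (p ^ 2 - 1) / 4 + (p + 1) := by
    have h2 : p ^ 2 = 4 * (4 * k ^ 2 - 2 * k) + 1 := by
      have h4 : 2 * k ≤ 4 * k ^ 2 := by nlinarith
      zify [h4]
      have : (p : ℤ) = 4 * k - 1 := by omega
      rw [this]; ring
    have h5 : (p ^ 2 - 1) / 4 = 4 * k ^ 2 - 2 * k := by omega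
    have h4 : 2 * k ≤ 4 * k ^ 2 := by nlinarith
    rw [h5]
    zify [h4]
    have : (p : ℤ) = 4 * k - 1 := by omega
    rw [this]; ring
  rw [show (p + 1) / 4 = k by omega] at key
  have hst := star_frob hpp h3 l
  have a1 : (p : ℤ[i]) ∣ (l ^ 3 * l ^ p) ^ k - (l ^ 3 * star l) ^ k := by
    refine dvd_trans ?_ (sub_dvd_pow_sub_pow _ _ k)
    rw [← mul_sub]; exact hst.mul_left _
  have a2 : (p : ℤ[i]) ∣ l ^ (p + 1) * (l ^ ((p ^ 2 - 1) / 4) - quartic (-p) l) := by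
    have := dvd_sub (dvd_add a1 key) (hst.mul_left (quartic (-p) l * l))
    convert this using 1
    rw [← pow_add, ← pow_mul, show (3 + p) * k = (p ^ 2 - 1) / 4 + (p + 1) by rw [← hexp]; ring]
    ring
  rw [hn]
  exact (hP.dvd_or_dvd a2).resolve_left fun h => n1 (hP.dvd_of_dvd_pow h)

/-- the signed version of an odd natural number -/
def sg (n : ℕ) : ℤ := if n % 4 = 1 then n else -n

lemma sg_mul {m n : ℕ} (hm : m % 2 = 1) (hn : n % 2 = 1) : sg (m * n) = sg m * sg n := by
  have h := Nat.mul_mod m n 4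
  have h1 : m % 4 = 1 ∨ m % 4 = 3 := by omega
  have h2 : n % 4 = 1 ∨ n % 4 = 3 := by omega
  unfold sg
  rcases h1 with h1 | h1 <;> rcases h2 with h2 | h2 <;> rw [h1, h2] at h <;> simp [h, h1, h2]

lemma rat_nat {l : ℤ[i]} (hl : Prime l) (hp : IsPrimary l) (n : ℕ) (ho : n % 2 = 1)
    (hc : IsCoprime (n : ℤ[i]) l) : quarticGen (sg n : ℤ) l = quarticGen l n := by
  induction n using Nat.recOnMul with
  | zero => simp at ho
  | one => simp [sg, quarticGen_one_left hp.isOdd, quarticGen_unit isUnit_one]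
  | prime p hpp =>
    rw [quarticGen_prime hl, sg]
    split_ifs with h
    · simpa using rat_one hl hp hpp h hc
    · simpa using rat_three hl hp hpp (by omega) hc
  | mul a b iha ihb =>
    have h2 := Nat.mul_mod a b 2
    have ha : a % 2 = 1 := by
      rcases Nat.mod_two_eq_zero_or_one a with h | h
      · simp [h] at h2; omega
      · exact h
    have hb : b % 2 = 1 := by
      rcases Nat.mod_two_eq_zero_or_one b with h | h
      · simp [h] at h2; omega
      · exact h
    rw [Nat.cast_mul] at hc
    rw [sg_mul ha hb, Int.cast_mul, Nat.cast_mul, quarticGen_mul_left hp.isOdd,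
      quarticGen_mul_right (isOdd_natCast ha).ne_zero (isOdd_natCast hb).ne_zero,
      iha ha hc.of_mul_left_left, ihb hb hc.of_mul_left_right]

lemma rat_int_prime {l : ℤ[i]} (hl : Prime l) (hp : IsPrimary l) (a : ℤ) (ha : a % 4 = 1)
    (hc : IsCoprime (a : ℤ[i]) l) : quarticGen a l = quarticGen l a := by
  rcases Int.natAbs_eq a with h | h
  · have := rat_nat hl hp a.natAbs (by omega) (by
      rw [h] at hc; simpa using hc)
    have hs : sg a.natAbs = a := by rw [sg, if_pos (by omega)]; omega
    rw [hs] at this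
    rw [this]
    congr 1
    conv_rhs => rw [h]
    simp
  · have hcast : (a : ℤ[i]) = - (a.natAbs : ℤ[i]) := by
      conv_lhs => rw [h]
      rw [Int.cast_neg, Int.cast_natCast]
    have := rat_nat hl hp a.natAbs (by omega) (by
      rw [hcast] at hc; exact (IsCoprime.neg_left_iff _ _).1 hc)
    have hs : sg a.natAbs = a := by rw [sg, if_neg (by omega)]; omega
    rw [hs] at this
    rw [this]
    apply quarticGen_assoc
    · rw [hcast]; exact (Associated.refl _).neg_right
    · exact (isOdd_natCast (by omega)).ne_zero

lemma rat_recip (a : ℤ) (ha : a % 4 = 1) {γ : ℤ[i]} (hγ : IsPrimary γ)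
    (hc : IsCoprime (a : ℤ[i]) γ) : quarticGen a γ = quarticGen γ a := by
  have hao : IsOdd (a : ℤ[i]) := isOdd_intCast (by omega)
  have key : ∀ β : ℤ[i], IsOdd β → ∀ γ, IsPrimary γ → Associated β γ → IsCoprime (a : ℤ[i]) γ →
      quarticGen a γ = quarticGen γ a := by
    intro β hβ
    induction β, hβ using odd_induction with
    | h1 u hu _ =>
      intro γ hγ h _
      have : γ = 1 := primary_assoc hγ isPrimary_one
        (h.symm.trans (associated_one_iff_isUnit.2 hu))
      rw [this, quarticGen_unit isUnit_one, quarticGen_one_left hao]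
    | h2 π β hπ ho hb ih =>
      intro γ hγ h hc
      obtain ⟨π', hp1, hp2⟩ := exists_primary ho
      obtain ⟨β', hb1, hb2⟩ := exists_primary hb
      have : γ = π' * β' := primary_assoc hγ (hp1.mul hb1) (h.symm.trans (hp2.mul_mul hb2))
      have hπ' : Prime π' := hp2.prime hπ
      rw [this] at hc ⊢
      rw [quarticGen_mul_right hp1.isOdd.ne_zero hb1.isOdd.ne_zero, quarticGen_mul_left hao,
        ih β' hb1 hb2 hc.of_mul_right_right, rat_int_prime hπ' hp1 a ha hc.of_mul_right_left]
  exact key γ hγ.isOdd γ hγ (Associated.refl _) hc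

lemma rat_rat_prime {p : ℕ} (hpp : p.Prime) (ho : p % 2 = 1) (b : ℤ)
    (hc : IsCoprime (b : ℤ[i]) p) : quarticGen b p = 1 := by
  have : Fact p.Prime := ⟨hpp⟩
  have hpo : IsOdd (p : ℤ[i]) := isOdd_natCast ho
  rcases (show p % 4 = 1 ∨ p % 4 = 3 by omega) with h1 | h3
  · obtain ⟨m, hm, hn, hpm⟩ := split_prime hpp h1
    have hmp : m ∣ (p : ℤ[i]) := hpm ▸ dvd_mul_right _ _
    have hs := prime_star hm
    have hmo := hpo.of_dvd hmp
    have hv := (quartic_spec hm hmo (not_dvd_of_coprime hm (hc.of_isCoprime_of_dvd_right hmp))).1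
    have e := quartic_star hm hmo b
    rw [star_intCast] at e
    rw [hpm, quarticGen_mul_right hm.ne_zero hs.ne_zero, quarticGen_prime hm, quarticGen_prime hs, e,
      fourth_mul_star _ hv]
  · have hP : Prime (p : ℤ[i]) := GaussianInt.prime_of_nat_prime_of_mod_four_eq_three p h3
    have nd := not_dvd_of_coprime hP hc
    rw [quarticGen_prime hP]
    apply quartic_unique hP hpo nd (one_pow 4)
    have hn : nn (p : ℤ[i]) = p ^ 2 := by
      zify; rw [nn_cast]; simp
    have hb : (b : ZMod p) ≠ 0 := by
      intro h
      apply nd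
      rw [ZMod.intCast_zmod_eq_zero_iff_dvd] at h
      have := map_dvd (Int.castRingHom ℤ[i]) h
      simpa using this
    have hk : (p ^ 2 - 1) / 4 = (p - 1) * ((p + 1) / 4) := by
      obtain ⟨k, hk⟩ : ∃ k, p = 4 * k + 3 := ⟨p / 4, by omega⟩
      have e1 : (p + 1) / 4 = k + 1 := by omega
      have e2 : p - 1 = 4 * k + 2 := by omega
      have e3 : p ^ 2 = 4 * ((4 * k + 2) * (k + 1)) + 1 := by rw [hk]; ring
      rw [e1, e2]; omega
    have hd : (p : ℤ) ∣ b ^ ((p ^ 2 - 1) / 4) - 1 := by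
      rw [← ZMod.intCast_zmod_eq_zero_iff_dvd]
      push_cast
      rw [hk, pow_mul, ZMod.pow_card_sub_one_eq_one hb, one_pow, sub_self]
    have := map_dvd (Int.castRingHom ℤ[i]) hd
    rw [hn]
    simpa using this

lemma rat_rat (a b : ℤ) (ha : a % 2 = 1) (hc : IsCoprime (b : ℤ[i]) a) :
    quarticGen b a = 1 := by
  have key : ∀ n : ℕ, n % 2 = 1 → IsCoprime (b : ℤ[i]) n → quarticGen b n = 1 := by
    intro n ho hc
    induction n using Nat.recOnMul with
    | zero => simp at ho
    | one => rw [Nat.cast_one]; exact quarticGen_unit isUnit_one _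
    | prime p hpp => exact rat_rat_prime hpp ho b hc
    | mul x y iha ihb =>
      have h2 := Nat.mul_mod x y 2
      have ha : x % 2 = 1 := by
        rcases Nat.mod_two_eq_zero_or_one x with h | h
        · simp [h] at h2; omega
        · exact h
      have hb : y % 2 = 1 := by
        rcases Nat.mod_two_eq_zero_or_one y with h | h
        · simp [h] at h2; omega
        · exact h
      rw [Nat.cast_mul] at hc ⊢
      rw [quarticGen_mul_right (isOdd_natCast ha).ne_zero (isOdd_natCast hb).ne_zero,
        iha ha hc.of_mul_right_left, ihb hb hc.of_mul_right_right, one_mul]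
  have hassoc : Associated (a : ℤ[i]) (a.natAbs : ℤ[i]) := by
    have := (Int.associated_natAbs a).map (Int.castRingHom ℤ[i])
    simpa using this
  rw [quarticGen_assoc hassoc (isOdd_intCast ha).ne_zero]
  apply key _ (by omega)
  exact hc.of_isCoprime_of_dvd_right hassoc.symm.dvd


/-- The sign `+1` for `1, 3` modulo `8` and `-1` otherwise. -/
def es (a : ℤ) : ℤ[i] := if a % 8 = 1 ∨ a % 8 = 3 then 1 else -1

lemma es_sq (a : ℤ) : es a * es a = 1 := by
  unfold es; split_ifs <;> norm_num

lemma star_es (a : ℤ) : star (es a) = es a := by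
  unfold es; split_ifs <;> simp

lemma es_mul {a c : ℤ} (ha : a % 2 = 1) (hc : c % 2 = 1) : es (a * c) = es a * es c := by
  have h := Int.mul_emod a c 8
  have h1 : a % 8 = 1 ∨ a % 8 = 3 ∨ a % 8 = 5 ∨ a % 8 = 7 := by omega
  have h2 : c % 8 = 1 ∨ c % 8 = 3 ∨ c % 8 = 5 ∨ c % 8 = 7 := by omega
  unfold es
  rcases h1 with h1 | h1 | h1 | h1 <;> rcases h2 with h2 | h2 | h2 | h2 <;>
    rw [h1, h2] at h <;> norm_num at h <;> simp [h, h1, h2]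

lemma es_add {a k : ℤ} (ha : a % 2 = 1) : es (a + 4 * k) = (if k % 2 = 0 then 1 else -1) * es a := by
  have h1 : a % 8 = 1 ∨ a % 8 = 3 ∨ a % 8 = 5 ∨ a % 8 = 7 := by omega
  unfold es
  split_ifs <;> first | omega | norm_num

lemma nn_int (a : ℤ) : (nn (a : ℤ[i]) : ℤ) = a ^ 2 := by
  rw [nn_cast]; simp

lemma gi_pow_int (a : ℤ) (ha : a % 2 = 1) :
    gi ^ ((nn (a : ℤ[i]) - 1) / 4) = if a % 8 = 1 ∨ a % 8 = 7 then 1 else -1 := by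
  have h := nn_int a
  have h1 : a % 8 = 1 ∨ a % 8 = 3 ∨ a % 8 = 5 ∨ a % 8 = 7 := by omega
  obtain ⟨k, hk⟩ : ∃ k, a = 8 * k + a % 8 := ⟨a / 8, by omega⟩
  rw [gi_pow_mod]
  generalize nn (a : ℤ[i]) = N at *
  have h' : (N : ℤ) = 64 * k ^ 2 + 16 * (k * (a % 8)) + (a % 8) ^ 2 := by
    rw [h]; conv_lhs => rw [hk]
    ring
  rcases h1 with h1 | h1 | h1 | h1 <;> rw [h1] at h' ⊢ <;> norm_num
  · have : (N - 1) / 4 % 4 = 0 := by omega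
    rw [this, pow_zero]
  · have : (N - 1) / 4 % 4 = 2 := by omega
    rw [this, gi_sq]
  · have : (N - 1) / 4 % 4 = 2 := by omega
    rw [this, gi_sq]
  · have : (N - 1) / 4 % 4 = 0 := by omega
    rw [this, pow_zero]

lemma nn_parity {γ : ℤ[i]} (h : IsPrimary γ) : ((((nn γ - 1) / 4 : ℕ)) : ℤ) % 2 = (γ.im / 2) % 2 := by
  rw [isPrimary_iff] at h
  obtain ⟨h1, h2⟩ := h
  have hn := nn_cast γ
  obtain ⟨y, hy⟩ : ∃ y, γ.im = 2 * y := ⟨γ.im / 2, by omega⟩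
  obtain ⟨x, hx⟩ : ∃ x, γ.re = 2 * x + 1 := ⟨γ.re / 2, by omega⟩
  obtain ⟨z, hz⟩ : ∃ z, x * (x + 1) = 2 * z := by
    have := Int.even_mul_succ_self x
    obtain ⟨z, hz⟩ := this
    exact ⟨z, by omega⟩
  obtain ⟨w, hw⟩ : ∃ w, y * (y - 1) = 2 * w := by
    have := Int.even_mul_pred_self y
    obtain ⟨z, hz⟩ := this
    exact ⟨z, by omega⟩
  have e : (nn γ : ℤ) = 4 * (2 * z + 2 * w + y) + 1 := by
    rw [hn, hx, hy]; linear_combination 4 * hz + 4 * hw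
  rw [hy]
  omega

lemma neg_one_pow_parity {γ : ℤ[i]} (h : IsPrimary γ) :
    (-1 : ℤ[i]) ^ ((nn γ - 1) / 4) = if γ.im % 4 = 0 then 1 else -1 := by
  have hp := nn_parity h
  rw [isPrimary_iff] at h
  split_ifs with h4
  · exact Even.neg_one_pow (Nat.even_iff.2 (by omega))
  · exact Odd.neg_one_pow (Nat.odd_iff.2 (by omega))

lemma decomp (z : ℤ[i]) : z = (z.re : ℤ[i]) + gi * (z.im : ℤ[i]) := by
  ext <;> simp [gi]

lemma F_lemma {γ : ℤ[i]} (h : IsPrimary γ) (hc : IsCoprime (γ.re : ℤ[i]) γ) :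
    quarticGen γ.re γ = es γ.re := by
  have hp := neg_one_pow_parity h
  have hodd := h.isOdd
  have h' := h
  rw [isPrimary_iff] at h'
  obtain ⟨h1, h2⟩ := h'
  have hro : γ.re % 2 = 1 := by omega
  have hr : IsOdd (γ.re : ℤ[i]) := isOdd_intCast hro
  have hcb : IsCoprime (γ.im : ℤ[i]) γ.re := by
    have h3 : IsCoprime (γ.re : ℤ[i]) (gi * γ.im) := by
      have e : gi * (γ.im : ℤ[i]) = γ + γ.re * (-1) := by linear_combination - decomp γ
      rw [e]
      exact IsCoprime.add_mul_left_right hc _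
    exact h3.of_mul_right_right.symm
  have hval : quarticGen γ γ.re = gi ^ ((nn (γ.re : ℤ[i]) - 1) / 4) := by
    rw [quarticGen_congr hr (α' := gi * γ.im), quarticGen_mul_left hr, rat_rat _ _ hro hcb, mul_one,
      quarticGen_gi hr]
    exact ⟨1, by linear_combination decomp γ⟩
  rw [gi_pow_int _ hro] at hval
  by_cases h4 : γ.im % 4 = 0
  · rw [rat_recip _ (by omega) h hc, hval]
    unfold es
    have : γ.re % 8 = 1 ∨ γ.re % 8 = 5 := by omega
    rcases this with h | h <;> simp [h]
  · rw [if_neg h4] at hp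
    have h5 := rat_recip (-γ.re) (by omega) h (by
      rw [Int.cast_neg]; exact (IsCoprime.neg_left_iff _ _).2 hc)
    have h6 : quarticGen γ ((-γ.re : ℤ) : ℤ[i]) = quarticGen γ γ.re := by
      apply quarticGen_assoc
      · rw [Int.cast_neg]; exact (Associated.refl _).neg_left
      · exact (isOdd_intCast (by omega)).ne_zero
    have h7 : (γ.re : ℤ[i]) = (-1) * ((-γ.re : ℤ) : ℤ[i]) := by push_cast; ring
    rw [h7, quarticGen_mul_left hodd, h5, h6, hval, quarticGen_neg_one hodd, hp]
    unfold es
    have : γ.re % 8 = 3 ∨ γ.re % 8 = 7 := by omega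
    rcases this with h | h <;> simp [h]

lemma isCoprime_star {x y : ℤ[i]} (h : IsCoprime x y) : IsCoprime (star x) (star y) :=
  h.map (starRingEnd ℤ[i])

lemma prim_sign {α β : ℤ[i]} (hα : IsPrimary α) (hβ : IsPrimary β) :
    es (α.re * β.re + α.im * β.im) =
      es α.re * es β.re * (-1 : ℤ[i]) ^ (((nn α - 1) / 4) * ((nn β - 1) / 4)) := by
  rw [pow_mul, neg_one_pow_parity hα]
  have hb := neg_one_pow_parity hβ
  have hα' := (isPrimary_iff α).1 hα
  have hβ' := (isPrimary_iff β).1 hβ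
  obtain ⟨b, hb'⟩ : ∃ b, α.im = 2 * b := ⟨α.im / 2, by omega⟩
  obtain ⟨d, hd'⟩ : ∃ d, β.im = 2 * d := ⟨β.im / 2, by omega⟩
  have e : α.im * β.im = 4 * (b * d) := by rw [hb', hd']; ring
  have ho : (α.re * β.re) % 2 = 1 := by
    rw [Int.mul_emod, show α.re % 2 = 1 by omega, show β.re % 2 = 1 by omega]; rfl
  rw [e, es_add ho, es_mul (by omega) (by omega), mul_comm]
  congr 1
  have hm := Int.mul_emod b d 2
  rcases Int.emod_two_eq_zero_or_one b with h0 | h0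
  · rw [h0, zero_mul] at hm
    rw [if_pos (by simpa using hm), if_pos (by omega), one_pow]
  · rw [if_neg (show ¬ α.im % 4 = 0 by omega), hb]
    rcases Int.emod_two_eq_zero_or_one d with h1 | h1
    · rw [h1, mul_zero] at hm
      rw [if_pos (by simpa using hm), if_pos (by omega)]
    · rw [h0, h1, one_mul] at hm
      rw [if_neg (by omega), if_neg (by omega)]

lemma prim_case {α β : ℤ[i]} (hα : IsPrimary α) (hβ : IsPrimary β) (hc : IsCoprime α β)
    (ha : IsCoprime (α.re : ℤ[i]) α) (hb : IsCoprime (β.re : ℤ[i]) β) :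
    quarticGen α β = (-1 : ℤ[i]) ^ (((nn α - 1) / 4) * ((nn β - 1) / 4)) * quarticGen β α := by
  have hs := prim_sign hα hβ
  set m : ℤ := α.re * β.re + α.im * β.im with hm
  have hmc : (m : ℤ[i]) = (α.re : ℤ[i]) * β.re + α.im * β.im := by rw [hm]; push_cast; rfl
  have m1 : (m : ℤ[i]) = α * β.re + β * (-(gi * α.im)) := by
    rw [hmc]; linear_combination (-(β.re : ℤ[i])) * decomp α + gi * α.im * decomp β
      + (α.im * β.im : ℤ[i]) * gi_mul
  have m2 : (m : ℤ[i]) = β * α.re + α * (-(gi * β.im)) := by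
    rw [hmc]; linear_combination (-(α.re : ℤ[i])) * decomp β + gi * β.im * decomp α
      + (α.im * β.im : ℤ[i]) * gi_mul
  have c1 : IsCoprime (m : ℤ[i]) β := by
    rw [m1]; exact IsCoprime.add_mul_left_left (hc.mul_left hb) _
  have c2 : IsCoprime (m : ℤ[i]) α := by
    rw [m2]; exact IsCoprime.add_mul_left_left (hc.symm.mul_left ha) _
  have c3 : IsCoprime (m : ℤ[i]) (star α) := by
    have := isCoprime_star c2
    rwa [star_intCast] at this
  have q1 : quarticGen m β = quarticGen α β * es β.re := by
    rw [← F_lemma hβ hb, ← quarticGen_mul_left hβ.isOdd]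
    exact quarticGen_congr hβ.isOdd ⟨-(gi * α.im), by rw [m1]; ring⟩
  have q2 : quarticGen m α = quarticGen β α * es α.re := by
    rw [← F_lemma hα ha, ← quarticGen_mul_left hα.isOdd]
    exact quarticGen_congr hα.isOdd ⟨-(gi * β.im), by rw [m2]; ring⟩
  have hP := hβ.mul hα.conj
  have hre : (β * star α).re = m := by simp [hm]; ring
  have q3 := F_lemma hP (by rw [hre]; exact c1.mul_right c3)
  rw [hre, quarticGen_mul_right hβ.isOdd.ne_zero hα.conj.isOdd.ne_zero, q1] at q3
  have q4 : quarticGen (m : ℤ[i]) (star α) = star (quarticGen β α) * es α.re := by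
    have := quarticGen_star hα.isOdd (m : ℤ[i])
    rw [star_intCast] at this
    rw [this, q2, star_mul', star_es]
  rw [q4, hs] at q3
  have hu := fourth_mul_star _ (quarticGen_fourth hα.isOdd hc.symm)
  have e1 := es_sq α.re
  have e2 := es_sq β.re
  have q5 : quarticGen α β * star (quarticGen β α)
      = (-1 : ℤ[i]) ^ (((nn α - 1) / 4) * ((nn β - 1) / 4)) := by
    have h0 : es α.re * es β.re ≠ 0 := by
      intro h
      have : (es α.re * es β.re) * (es α.re * es β.re) = 1 := by
        rw [mul_mul_mul_comm, e1, e2, one_mul]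
      rw [h] at this; norm_num at this
    apply mul_left_cancel₀ h0
    rw [← q3]; ring
  rw [← q5, mul_assoc, mul_comm (star _), hu, mul_one]

lemma exists_prim {α : ℤ[i]} (hα : IsPrimary α) : ∃ (n : ℤ) (α' : ℤ[i]), n % 4 = 1 ∧
    IsPrimary α' ∧ α = n * α' ∧ IsCoprime (α'.re : ℤ[i]) α' := by
  have hα' := (isPrimary_iff α).1 hα
  obtain ⟨g, x, y, hg, hxy, hx, hy⟩ := Int.exists_gcd_one' (m := α.re) (n := α.im)
    (Int.gcd_pos_of_ne_zero_left _ (by omega))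
  obtain ⟨n, s, hs, hn, hgn⟩ : ∃ n s : ℤ, s * s = 1 ∧ n % 4 = 1 ∧ (g : ℤ) = n * s := by
    have ho : g % 2 = 1 := by
      rcases Nat.mod_two_eq_zero_or_one g with h | h
      · exfalso
        obtain ⟨k, hk⟩ : ∃ k, g = 2 * k := ⟨g / 2, by omega⟩
        have : α.re = 2 * (x * k) := by rw [hx, hk]; push_cast; ring
        omega
      · exact h
    rcases (show g % 4 = 1 ∨ g % 4 = 3 by omega) with h | h
    · exact ⟨g, 1, by norm_num, by omega, by ring⟩
    · exact ⟨-g, -1, by norm_num, by omega, by ring⟩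
  have hX : α.re = n * (s * x) := by rw [hx, hgn]; ring
  have hY : α.im = n * (s * y) := by rw [hy, hgn]; ring
  refine ⟨n, ⟨s * x, s * y⟩, hn, ?_, ?_, ?_⟩
  · rw [isPrimary_iff]
    simp only
    rw [hX, hY] at hα'
    obtain ⟨k, hk⟩ : ∃ k, n = 4 * k + 1 := ⟨n / 4, by omega⟩
    rw [hk] at hα'
    have e1 : (4 * k + 1) * (s * x) = 4 * (k * (s * x)) + s * x := by ring
    have e2 : (4 * k + 1) * (s * y) = 4 * (k * (s * y)) + s * y := by ring
    rw [e1, e2] at hα'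
    omega
  · ext <;> simp [hX, hY]
  · have h1 : IsCoprime x y := Int.isCoprime_iff_gcd_eq_one.2 hxy
    have hsu : IsUnit s := IsUnit.of_mul_eq_one _ hs
    have h2 : IsCoprime (s * x) (s * y) := by
      rw [isCoprime_mul_unit_left_left hsu, isCoprime_mul_unit_left_right hsu]; exact h1
    have h3 := h2.map (Int.castRingHom ℤ[i])
    simp only [eq_intCast] at h3
    have hgu : IsUnit gi := fourth_isUnit gi_four
    have h4 := (isCoprime_mul_unit_left_right hgu _ _).2 h3
    have h5 := IsCoprime.add_mul_left_right h4 1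
    have e := decomp (⟨s * x, s * y⟩ : ℤ[i])
    rw [e]
    simpa [add_comm, gi_re] using h5

lemma pow_scale {n : ℤ} {α α' : ℤ[i]} (hn : n % 4 = 1) (h : IsPrimary α) (h' : IsPrimary α')
    (e : α = n * α') : (-1 : ℤ[i]) ^ ((nn α - 1) / 4) = (-1 : ℤ[i]) ^ ((nn α' - 1) / 4) := by
  rw [neg_one_pow_parity h, neg_one_pow_parity h']
  have hi : α.im = n * α'.im := by rw [e]; simp
  obtain ⟨k, hk⟩ : ∃ k, n = 4 * k + 1 := ⟨n / 4, by omega⟩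
  have e1 : n * α'.im = 4 * (k * α'.im) + α'.im := by rw [hk]; ring
  have : α.im % 4 = α'.im % 4 := by omega
  rw [this]

lemma main_aux {α β : ℤ[i]} (hα : IsPrimary α) (hβ : IsPrimary β) (hc : IsCoprime α β) :
    quarticGen α β = (-1 : ℤ[i]) ^ (((nn α - 1) / 4) * ((nn β - 1) / 4)) * quarticGen β α := by
  obtain ⟨n, α', hn, ha', ea, hac⟩ := exists_prim hα
  obtain ⟨k, β', hk, hb', eb, hbc⟩ := exists_prim hβ
  have hno : IsOdd (n : ℤ[i]) := isOdd_intCast (by omega)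
  have hko : IsOdd (k : ℤ[i]) := isOdd_intCast (by omega)
  have sgn : (-1 : ℤ[i]) ^ (((nn α - 1) / 4) * ((nn β - 1) / 4))
      = (-1 : ℤ[i]) ^ (((nn α' - 1) / 4) * ((nn β' - 1) / 4)) := by
    rw [pow_mul, pow_scale hn hα ha' ea, ← pow_mul, mul_comm, pow_mul, pow_scale hk hβ hb' eb,
      ← pow_mul, mul_comm]
  have cnb : IsCoprime (n : ℤ[i]) β := by rw [ea] at hc; exact hc.of_mul_left_left
  have cab : IsCoprime α' β := by rw [ea] at hc; exact hc.of_mul_left_right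
  have cak : IsCoprime α' k := by rw [eb] at cab; exact cab.of_mul_right_left
  have cab' : IsCoprime α' β' := by rw [eb] at cab; exact cab.of_mul_right_right
  have l1 : quarticGen α β = quarticGen n β * (quarticGen α' k * quarticGen α' β') := by
    rw [← quarticGen_mul_right hko.ne_zero hb'.isOdd.ne_zero, ← eb, ← quarticGen_mul_left hβ.isOdd,
      ← ea]
  have l2 : quarticGen β α = quarticGen β n * (quarticGen k α' * quarticGen β' α') := by
    rw [← quarticGen_mul_left ha'.isOdd, ← eb,
      ← quarticGen_mul_right hno.ne_zero ha'.isOdd.ne_zero, ← ea]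
  rw [l1, l2, sgn, rat_recip n hn hβ cnb, ← rat_recip k hk ha' cak.symm,
    prim_case ha' hb' cab' hac hbc]
  ring

/-- Quartic reciprocity: for primary, non-unit, relatively prime Gaussian
integers `α` and `β`,
`(α/β)₄ = (-1)^(((Nα-1)/4)·((Nβ-1)/4)) · (β/α)₄`. -/
theorem quartic_reciprocity (α β : ℤ[i]) (hα : IsPrimary α) (hβ : IsPrimary β)
    (hαu : ¬ IsUnit α) (hβu : ¬ IsUnit β) (hcop : IsCoprime α β) :
    quarticGen α β =
      (-1 : ℤ[i]) ^ (((α.norm.natAbs - 1) / 4) * ((β.norm.natAbs - 1) / 4)) *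
        quarticGen β α := by
  exact main_aux hα hβ hcop
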